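/- Let (X,d,W) be a uniformly convex hyperbolic space with a monotone modulus of uniform convexity η, C a nonempty convex subset, T : C → C asymptotically nonexpansive with sequence (k_n), K ≥ 0 with Σ_{n=0}^∞ k_n ≤ K, and L ∈ ℕ, L ≥ 2, with 1/L ≤ λ_n ≤ 1 − 1/L for all n. If T has a fixed point, then T is λ_n-asymptotically regular: for every x ∈ C, the Krasnoselski–Mann iteration (x_n) starting from x satisfies lim_{n→∞} d(x_n, T x_n) = 0. -/

import Mathlib

open Filter Set

section Hyperbolic

variable {X : Type*}

/-- A hyperbolic space structure: `W x y t` represents `(1-t)x ⊕ t y`. -/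
structure IsWMap [MetricSpace X] (W : X → X → ℝ → X) : Prop where
  w1 : ∀ (x y z : X), ∀ t ∈ Set.Icc (0:ℝ) 1,
    dist z (W x y t) ≤ (1 - t) * dist z x + t * dist z y
  w2 : ∀ (x y : X), ∀ t ∈ Set.Icc (0:ℝ) 1, ∀ s ∈ Set.Icc (0:ℝ) 1,
    dist (W x y t) (W x y s) = |t - s| * dist x y
  w3 : ∀ (x y : X), ∀ t ∈ Set.Icc (0:ℝ) 1, W x y t = W y x (1 - t)
  w4 : ∀ (x y z w : X), ∀ t ∈ Set.Icc (0:ℝ) 1,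
    dist (W x z t) (W y w t) ≤ (1 - t) * dist x y + t * dist z w

/-- `η` is a modulus of uniform convexity for the hyperbolic space `(X, dist, W)`. -/
def IsUCModulus [MetricSpace X] (W : X → X → ℝ → X) (η : ℝ → ℝ → ℝ) : Prop :=
  (∀ r ε : ℝ, 0 < r → ε ∈ Set.Ioc (0:ℝ) 2 → η r ε ∈ Set.Ioc (0:ℝ) 1) ∧
  (∀ r ε : ℝ, ∀ a x y : X, 0 < r → ε ∈ Set.Ioc (0:ℝ) 2 →
    dist x a ≤ r → dist y a ≤ r → ε * r ≤ dist x y →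
    dist (W x y (1/2)) a ≤ (1 - η r ε) * r)

/-- The modulus `η` is monotone: nonincreasing in `r` for each fixed `ε`. -/
def MonotoneUCModulus (η : ℝ → ℝ → ℝ) : Prop :=
  ∀ ε ∈ Set.Ioc (0:ℝ) 2, ∀ r s : ℝ, 0 < r → r ≤ s → η s ε ≤ η r ε

/-- `C` is a convex subset w.r.t. the convexity map `W`. -/
def WConvex [MetricSpace X] (W : X → X → ℝ → X) (C : Set X) : Prop :=
  ∀ x ∈ C, ∀ y ∈ C, ∀ t ∈ Set.Icc (0:ℝ) 1, W x y t ∈ C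

/-- `T : C → C` is asymptotically nonexpansive with sequence `k`. -/
def AsymptoticallyNonexpansive [MetricSpace X] (C : Set X) (T : X → X) (k : ℕ → ℝ) : Prop :=
  Set.MapsTo T C C ∧ (∀ n, 0 ≤ k n) ∧
  Filter.Tendsto k Filter.atTop (nhds 0) ∧
  ∀ n : ℕ, ∀ x ∈ C, ∀ y ∈ C, dist (T^[n] x) (T^[n] y) ≤ (1 + k n) * dist x y

/-- `xseq` is the Krasnoselski–Mann iteration of `T` starting from `x`:
`x₀ = x`, `x_{n+1} = (1-λ_n) x_n ⊕ λ_n T^n x_n`. -/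
def IsKMIteration [MetricSpace X] (W : X → X → ℝ → X) (T : X → X) (lam : ℕ → ℝ)
    (x : X) (xseq : ℕ → X) : Prop :=
  xseq 0 = x ∧ ∀ n, xseq (n + 1) = W (xseq n) (T^[n] (xseq n)) (lam n)

end Hyperbolic

theorem tendsto_of_le_one_add_mul {a k : ℕ → ℝ} {K : ℝ} (ha : ∀ n, 0 ≤ a n)
    (hk : ∀ n, 0 ≤ k n) (hsum : ∀ n : ℕ, ∑ i ∈ Finset.range n, k i ≤ K)
    (hrec : ∀ n, a (n + 1) ≤ (1 + k n) * a n) :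
    ∃ c, Tendsto a atTop (nhds c) := by
  set P : ℕ → ℝ := fun n => ∏ i ∈ Finset.range n, (1 + k i)
  have hPs : ∀ n, P (n + 1) = P n * (1 + k n) := fun n => Finset.prod_range_succ _ _
  have hPpos : ∀ n, 0 < P n := fun n => Finset.prod_pos fun i _ => by linarith [hk i]
  have hPmono : Monotone P := monotone_nat_of_le_succ fun n => by
    rw [hPs]; nlinarith [hPpos n, hk n]
  have hPbdd : ∀ n, P n ≤ Real.exp K := fun n =>
    calc P n ≤ ∏ i ∈ Finset.range n, Real.exp (k i) :=
          Finset.prod_le_prod (fun i _ => by linarith [hk i])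
            (fun i _ => by linarith [Real.add_one_le_exp (k i)])
      _ = Real.exp (∑ i ∈ Finset.range n, k i) := (Real.exp_sum _ _).symm
      _ ≤ Real.exp K := Real.exp_le_exp.2 (hsum n)
  have hbanti : Antitone fun n => a n / P n := antitone_nat_of_succ_le fun n => by
    rw [hPs, div_le_div_iff₀ (mul_pos (hPpos n) (by linarith [hk n])) (hPpos n)]
    calc a (n + 1) * P n ≤ (1 + k n) * a n * P n :=
          mul_le_mul_of_nonneg_right (hrec n) (hPpos n).le
      _ = a n * (P n * (1 + k n)) := by ring
  have hPlim := tendsto_atTop_ciSup hPmono ⟨Real.exp K, by rintro _ ⟨n, rfl⟩; exact hPbdd n⟩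
  have hblim := tendsto_atTop_ciInf hbanti
    ⟨0, by rintro _ ⟨n, rfl⟩; exact div_nonneg (ha n) (hPpos n).le⟩
  refine ⟨_, (hblim.mul hPlim).congr fun n => ?_⟩
  exact div_mul_cancel₀ _ (hPpos n).ne'

section Hyperbolic

variable {X : Type*} [MetricSpace X] {W : X → X → ℝ → X} {η : ℝ → ℝ → ℝ}

theorem IsWMap.dist_left_le (hW : IsWMap W) (x y : X) {t : ℝ} (ht : t ∈ Set.Icc (0:ℝ) 1) :
    dist x (W x y t) ≤ t * dist x y := by
  simpa using hW.w1 x y x t ht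

theorem IsWMap.dist_right_le (hW : IsWMap W) (x y : X) {t : ℝ} (ht : t ∈ Set.Icc (0:ℝ) 1) :
    dist y (W x y t) ≤ (1 - t) * dist x y := by
  simpa [dist_comm y x] using hW.w1 x y y t ht

/-- In a uniformly convex hyperbolic space a point between `x` and `y` is determined by its
distances to `x` and `y`. -/
theorem IsUCModulus.eq_of_dist_le (hW : IsWMap W) (hUC : IsUCModulus W η) {x y z w : X}
    {s t : ℝ} (hs : 0 < s) (hst : s + t ≤ dist x y)
    (hzx : dist z x ≤ s) (hwx : dist w x ≤ s) (hzy : dist y z ≤ t) (hwy : dist y w ≤ t) :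
    z = w := by
  by_contra hne
  have hd : 0 < dist z w := dist_pos.2 hne
  have hd2 : dist z w ≤ 2 * s := by linarith [dist_triangle_right z w x]
  have hε : dist z w / s ∈ Set.Ioc (0:ℝ) 2 := ⟨div_pos hd hs, (div_le_iff₀ hs).2 hd2⟩
  have hm := hUC.2 s _ x z w hs hε hzx hwx (div_mul_cancel₀ _ hs.ne').le
  have hη := mul_pos (hUC.1 s _ hs hε).1 hs
  have hy := hW.w1 z w y (1 / 2) ⟨by norm_num, by norm_num⟩
  have htri := dist_triangle_left x y (W z w (1 / 2))
  rw [dist_comm (W z w (1 / 2)) y] at htri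
  linarith

theorem IsUCModulus.dist_le_of_le_half (hW : IsWMap W) (hUC : IsUCModulus W η) {x y a : X}
    {r ε l u : ℝ} (hr : 0 < r) (hε : ε ∈ Set.Ioc (0:ℝ) 2) (hx : dist x a ≤ r)
    (hy : dist y a ≤ r) (hxy : ε * r ≤ dist x y) (hu : 0 < u) (hul : u ≤ l) (hl : l ≤ 1 / 2) :
    dist (W x y l) a ≤ (1 - 2 * u * η r ε) * r := by
  have hl0 : 0 < l := hu.trans_le hul
  have hlI : l ∈ Set.Icc (0:ℝ) 1 := ⟨hl0.le, by linarith⟩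
  have h2lI : 2 * l ∈ Set.Icc (0:ℝ) 1 := ⟨by linarith, by linarith⟩
  have hhalf : (1 / 2 : ℝ) ∈ Set.Icc (0:ℝ) 1 := ⟨by norm_num, by norm_num⟩
  have hd : 0 < dist x y := (mul_pos hε.1 hr).trans_le hxy
  have hm := hUC.2 r ε a x y hr hε hx hy hxy
  have hη := hUC.1 r ε hr hε
  have hxm := hW.dist_left_le x y hhalf
  have hym := hW.dist_right_le x y hhalf
  set m := W x y (1 / 2)
  have heq : W x y l = W x m (2 * l) := by
    refine hUC.eq_of_dist_le hW (x := x) (y := y) (s := l * dist x y) (t := (1 - l) * dist x y)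
      (mul_pos hl0 hd) (by linarith) ?_ ?_ (hW.dist_right_le x y hlI) ?_
    · rw [dist_comm]; exact hW.dist_left_le x y hlI
    · rw [dist_comm]
      refine (hW.dist_left_le x m h2lI).trans ?_
      nlinarith
    · have := hW.w1 x m y (2 * l) h2lI
      rw [dist_comm y x] at this
      nlinarith
  have h1 := hW.w1 x m a (2 * l) h2lI
  rw [heq, dist_comm]
  rw [dist_comm a x, dist_comm a m] at h1
  have h2 : (1 - 2 * l) * dist x a ≤ (1 - 2 * l) * r :=
    mul_le_mul_of_nonneg_left hx (by linarith)
  have h3 : 2 * l * dist m a ≤ 2 * l * ((1 - η r ε) * r) :=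
    mul_le_mul_of_nonneg_left hm h2lI.1
  have h4 : u * (η r ε * r) ≤ l * (η r ε * r) :=
    mul_le_mul_of_nonneg_right hul (mul_pos hη.1 hr).le
  linarith

theorem IsUCModulus.dist_le (hW : IsWMap W) (hUC : IsUCModulus W η) {x y a : X}
    {r ε l u : ℝ} (hr : 0 < r) (hε : ε ∈ Set.Ioc (0:ℝ) 2) (hx : dist x a ≤ r)
    (hy : dist y a ≤ r) (hxy : ε * r ≤ dist x y) (hu : 0 < u) (hul : u ≤ l) (hl : l ≤ 1 - u) :
    dist (W x y l) a ≤ (1 - 2 * u * η r ε) * r := by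
  rcases le_total l (1 / 2) with h | h
  · exact hUC.dist_le_of_le_half hW hr hε hx hy hxy hu hul h
  · rw [hW.w3 x y l ⟨by linarith, by linarith⟩]
    rw [dist_comm x y] at hxy
    exact hUC.dist_le_of_le_half hW hr hε hy hx hxy hu (by linarith) (by linarith)

theorem IsKMIteration.mem {T : X → X} {lam : ℕ → ℝ} {C : Set X} {x : X} {xseq : ℕ → X}
    (hx : IsKMIteration W T lam x xseq) (hconv : WConvex W C) (hT : Set.MapsTo T C C)
    (hlam : ∀ n, lam n ∈ Set.Icc (0:ℝ) 1) (hxC : x ∈ C) (n : ℕ) : xseq n ∈ C := by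
  induction n with
  | zero => rwa [hx.1]
  | succ n ih => rw [hx.2]; exact hconv _ ih _ (hT.iterate n ih) _ (hlam n)

/-- A uniform gap `δ` between `x` and `y` makes every admissible convex combination closer to `a`
by a fixed amount. -/
theorem IsUCModulus.exists_gap (hW : IsWMap W) (hUC : IsUCModulus W η)
    (hMon : MonotoneUCModulus η) {R δ u : ℝ} (hδ : 0 < δ) (hu : 0 < u) :
    ∃ θ > 0, ∀ (x y a : X) (r l : ℝ), r ≤ R → dist x a ≤ r → dist y a ≤ r → δ ≤ dist x y →
      u ≤ l → l ≤ 1 - u → dist (W x y l) a ≤ r - θ := by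
  by_cases hR : δ ≤ 2 * R
  · have hRpos : 0 < R := by linarith
    have hε : δ / R ∈ Set.Ioc (0:ℝ) 2 := ⟨div_pos hδ hRpos, (div_le_iff₀ hRpos).2 hR⟩
    have hη := (hUC.1 R _ hRpos hε).1
    refine ⟨u * η R (δ / R) * δ, by positivity, fun x y a r l hrR hx hy hxy hul hl => ?_⟩
    have hr : δ ≤ 2 * r := by linarith [dist_triangle_right x y a]
    have hr0 : 0 < r := by linarith
    have hgap : δ / R * r ≤ dist x y := by
      refine le_trans ?_ hxy
      calc δ / R * r ≤ δ / R * R := mul_le_mul_of_nonneg_left hrR hε.1.le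
        _ = δ := div_mul_cancel₀ _ hRpos.ne'
    have h := hUC.dist_le hW hr0 hε hx hy hgap hu hul hl
    have h1 : u * η R (δ / R) * δ ≤ u * η r (δ / R) * (2 * r) :=
      mul_le_mul (mul_le_mul_of_nonneg_left (hMon _ hε r R hr0 hrR) hu.le) hr hδ.le
        (mul_nonneg hu.le (hη.le.trans (hMon _ hε r R hr0 hrR)))
    linarith
  · refine ⟨1, one_pos, fun x y a r l hrR hx hy hxy _ _ => ?_⟩
    linarith [dist_triangle_right x y a]

theorem IsKMIteration.tendsto_dist_iterate {T : X → X} {k lam : ℕ → ℝ} {C : Set X} {x p : X}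
    {xseq : ℕ → X} {K u : ℝ} (hx : IsKMIteration W T lam x xseq) (hW : IsWMap W)
    (hUC : IsUCModulus W η) (hMon : MonotoneUCModulus η)
    (hT : AsymptoticallyNonexpansive C T k)
    (hsum : ∀ n : ℕ, ∑ i ∈ Finset.range n, k i ≤ K) (hu : 0 < u)
    (hlam : ∀ n, u ≤ lam n ∧ lam n ≤ 1 - u) (hp : p ∈ C) (hTp : T p = p)
    (hC : ∀ n, xseq n ∈ C) :
    Tendsto (fun n => dist (xseq n) (T^[n] (xseq n))) atTop (nhds 0) := by
  obtain ⟨-, hk, hk0, hTn⟩ := hT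
  have hy : ∀ n, dist (T^[n] (xseq n)) p ≤ (1 + k n) * dist (xseq n) p := fun n => by
    simpa [Function.iterate_fixed hTp n] using hTn n _ (hC n) p hp
  have hx' : ∀ n, dist (xseq n) p ≤ (1 + k n) * dist (xseq n) p := fun n =>
    le_mul_of_one_le_left dist_nonneg (by linarith [hk n])
  have hrec : ∀ n, dist (xseq (n + 1)) p ≤ (1 + k n) * dist (xseq n) p := fun n => by
    have hl := hlam n
    have h := hW.w1 (xseq n) (T^[n] (xseq n)) p (lam n) ⟨by linarith, by linarith⟩
    rw [← hx.2 n, dist_comm p, dist_comm p, dist_comm p] at h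
    nlinarith [mul_le_mul_of_nonneg_left (hx' n) (show 0 ≤ 1 - lam n by linarith),
      mul_le_mul_of_nonneg_left (hy n) (show 0 ≤ lam n by linarith)]
  obtain ⟨c, hc⟩ := tendsto_of_le_one_add_mul (fun n => dist_nonneg) hk hsum hrec
  have hr : Tendsto (fun n => (1 + k n) * dist (xseq n) p) atTop (nhds c) := by
    simpa using (hk0.const_add 1).mul hc
  obtain ⟨R, hR⟩ := hr.bddAbove_range
  rw [Metric.tendsto_atTop']
  intro δ hδ
  obtain ⟨θ, hθ, hgap⟩ := hUC.exists_gap hW hMon (R := R) hδ hu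
  have hdiff : Tendsto (fun n => (1 + k n) * dist (xseq n) p - dist (xseq (n + 1)) p)
      atTop (nhds 0) := by
    simpa using hr.sub (hc.comp (tendsto_add_atTop_nat 1))
  obtain ⟨N, hN⟩ := eventually_atTop.1 (hdiff.eventually_lt_const hθ)
  refine ⟨N, fun n hn => ?_⟩
  rw [Real.dist_0_eq_abs, abs_of_nonneg dist_nonneg]
  by_contra! hcon
  have h := hgap _ _ p _ _ (hR ⟨n, rfl⟩) (hx' n) (hy n) hcon (hlam n).1 (hlam n).2
  rw [← hx.2 n] at h
  linarith [hN n hn.le]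

theorem IsKMIteration.tendsto_dist_map {T : X → X} {k lam : ℕ → ℝ} {C : Set X} {x : X}
    {xseq : ℕ → X} (hx : IsKMIteration W T lam x xseq) (hW : IsWMap W)
    (hT : AsymptoticallyNonexpansive C T k) (hlam : ∀ n, lam n ∈ Set.Icc (0:ℝ) 1)
    (hC : ∀ n, xseq n ∈ C)
    (hlim : Tendsto (fun n => dist (xseq n) (T^[n] (xseq n))) atTop (nhds 0)) :
    Tendsto (fun n => dist (xseq n) (T (xseq n))) atTop (nhds 0) := by
  obtain ⟨hmaps, hk, hk0, hTn⟩ := hT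
  rw [← tendsto_add_atTop_iff_nat 1]
  set e : ℕ → ℝ := fun n => dist (xseq n) (T^[n] (xseq n))
  have hstep : ∀ n, dist (xseq n) (xseq (n + 1)) ≤ e n := fun n => by
    rw [hx.2 n]
    exact (hW.dist_left_le _ _ (hlam n)).trans (mul_le_of_le_one_left dist_nonneg (hlam n).2)
  have hbound : ∀ n, dist (xseq (n + 1)) (T (xseq (n + 1))) ≤
      e (n + 1) + (1 + k 1) * ((1 + k n) * e n + e n + e n) := fun n => by
    have h1 : dist (T^[n + 1] (xseq (n + 1))) (T (xseq (n + 1))) ≤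
        (1 + k 1) * dist (T^[n] (xseq (n + 1))) (xseq (n + 1)) := by
      rw [Function.iterate_succ_apply']
      exact hTn 1 _ (hmaps.iterate n (hC _)) _ (hC _)
    have h2 : dist (T^[n] (xseq (n + 1))) (xseq (n + 1)) ≤ (1 + k n) * e n + e n + e n := by
      have h3 := hTn n _ (hC (n + 1)) _ (hC n)
      have h4 := mul_le_mul_of_nonneg_left (hstep n) (show 0 ≤ 1 + k n by linarith [hk n])
      have h5 := dist_triangle4 (T^[n] (xseq (n + 1))) (T^[n] (xseq n)) (xseq n) (xseq (n + 1))
      rw [dist_comm (xseq (n + 1))] at h3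
      rw [dist_comm (T^[n] (xseq n)) (xseq n)] at h5
      linarith [hstep n]
    refine (dist_triangle _ (T^[n + 1] (xseq (n + 1))) _).trans (add_le_add le_rfl ?_)
    exact h1.trans (mul_le_mul_of_nonneg_left h2 (by linarith [hk 1]))
  refine squeeze_zero (fun n => dist_nonneg) hbound ?_
  have h := (hlim.comp (tendsto_add_atTop_nat 1)).add
    (((((hk0.const_add 1).mul hlim).add hlim).add hlim).const_mul (1 + k 1))
  simpa using h

end Hyperbolic

/-- if `T` has a fixed point then `T` is `λₙ`-asymptotically regular. -/
theorem asymptotic_regularity_of_fixed_point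
    {X : Type*} [MetricSpace X]
    (W : X → X → ℝ → X) (η : ℝ → ℝ → ℝ)
    (hW : IsWMap W) (hUC : IsUCModulus W η) (hMon : MonotoneUCModulus η)
    (C : Set X) (hne : C.Nonempty) (hconv : WConvex W C)
    (T : X → X) (k : ℕ → ℝ) (hT : AsymptoticallyNonexpansive C T k)
    (K : ℝ) (hK : 0 ≤ K) (hsum : ∀ n : ℕ, ∑ i ∈ Finset.range n, k i ≤ K)
    (L : ℕ) (hL : 2 ≤ L) (lam : ℕ → ℝ)
    (hlam : ∀ n, 1 / (L : ℝ) ≤ lam n ∧ lam n ≤ 1 - 1 / (L : ℝ))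
    (hfix : ∃ p ∈ C, T p = p) :
    ∀ x ∈ C, ∀ xseq : ℕ → X, IsKMIteration W T lam x xseq →
      Filter.Tendsto (fun n => dist (xseq n) (T (xseq n))) Filter.atTop (nhds 0) := by
  intro x hx xseq hxseq
  obtain ⟨p, hp, hTp⟩ := hfix
  have hu : 0 < 1 / (L : ℝ) := by
    have : (0 : ℝ) < L := by exact_mod_cast (by omega : 0 < L)
    positivity
  have hlamI : ∀ n, lam n ∈ Set.Icc (0:ℝ) 1 := fun n =>
    ⟨hu.le.trans (hlam n).1, by linarith [(hlam n).2]⟩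
  have hC := hxseq.mem hconv hT.1 hlamI hx
  exact hxseq.tendsto_dist_map hW hT hlamI hC
    (hxseq.tendsto_dist_iterate hW hUC hMon hT hsum hu hlam hp hTp hC)
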